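/- For all α, β ∈ SL₂(ℤ) one has −A(R, αR)·A(R, Rβ)·A(RαR, RβR)·B(β) = A(αR, Rβ)·B(αβ). -/

import Mathlib

open Matrix

noncomputable section

abbrev GL2Z := GL (Fin 2) ℤ

/-- The Hilbert symbol at the infinite place of `ℚ`:
`(a,b) = -1` if `a < 0` and `b < 0`, and `(a,b) = 1` otherwise. -/
def hilb (a b : ℚ) : ℤˣ := if a < 0 ∧ b < 0 then -1 else 1

/-- Kubota's function `χ`: for `γ = [[a,b],[c,d]]`, `χ(γ) = c` if `c ≠ 0`, else `χ(γ) = d`. -/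
def chi (γ : GL2Z) : ℤ :=
  if (γ : Matrix (Fin 2) (Fin 2) ℤ) 1 0 = 0 then (γ : Matrix (Fin 2) (Fin 2) ℤ) 1 1
  else (γ : Matrix (Fin 2) (Fin 2) ℤ) 1 0

/-- The determinant of an element of `GL₂(ℤ)`, as an integer. -/
def detZ (γ : GL2Z) : ℤ := ((γ : Matrix (Fin 2) (Fin 2) ℤ)).det

/-- Kubota's twisted 2-cocycle
`A(α,β) = (det α, det β)·(χ(αβ)/χ(α), χ(αβ)/(χ(β)·det α))`. -/
def KA (α β : GL2Z) : ℤˣ :=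
  hilb (detZ α) (detZ β) *
    hilb ((chi (α * β) : ℚ) / (chi α : ℚ))
      ((chi (α * β) : ℚ) / ((chi β : ℚ) * (detZ α : ℚ)))

/-- The matrix `R = [[-1,0],[0,1]]` as an element of `GL₂(ℤ)`. -/
def Rm : GL2Z :=
  ⟨!![-1, 0; 0, 1], !![-1, 0; 0, 1],
    by rw [Matrix.mul_fin_two, Matrix.one_fin_two]; norm_num,
    by rw [Matrix.mul_fin_two, Matrix.one_fin_two]; norm_num⟩

/-- `B(γ) = (χ(γ), χ(γR))`. -/
def KB (γ : GL2Z) : ℤˣ := hilb (chi γ) (chi (γ * Rm))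

lemma div_neg_iff_xor {K : Type*} [Field K] [LinearOrder K] [IsStrictOrderedRing K]
    {a b : K} (ha : a ≠ 0) (hb : b ≠ 0) : a / b < 0 ↔ ¬(a < 0 ↔ b < 0) := by
  rw [div_neg_iff]
  grind

lemma mul_neg_iff_xor {a b : ℤ} (ha : a ≠ 0) (hb : b ≠ 0) :
    a * b < 0 ↔ ¬(a < 0 ↔ b < 0) := by
  rw [mul_neg_iff]
  grind

lemma hilb_div_div {x y z : ℤ} (hx : x ≠ 0) (hy : y ≠ 0) (hz : z ≠ 0) :
    hilb ((z : ℚ) / x) ((z : ℚ) / y) =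
      if ¬(z < 0 ↔ x < 0) ∧ ¬(z < 0 ↔ y < 0) then -1 else 1 := by
  have hx' : (x : ℚ) ≠ 0 := by exact_mod_cast hx
  have hy' : (y : ℚ) ≠ 0 := by exact_mod_cast hy
  have hz' : (z : ℚ) ≠ 0 := by exact_mod_cast hz
  simp only [hilb, div_neg_iff_xor hz' hx', div_neg_iff_xor hz' hy', Int.cast_lt_zero]

lemma hilb_intCast (x y : ℤ) : hilb x y = if x < 0 ∧ y < 0 then -1 else 1 := by
  simp only [hilb, Int.cast_lt_zero]

lemma detZ_mul (α β : GL2Z) : detZ (α * β) = detZ α * detZ β := by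
  simp [detZ]

lemma detZ_Rm : detZ Rm = -1 := by
  simp [detZ, Rm, Matrix.det_fin_two]

lemma Rm_mul_Rm : Rm * Rm = 1 := by
  ext i j
  fin_cases i <;> fin_cases j <;> simp [Rm]

lemma chi_Rm : chi Rm = 1 := by
  simp [chi, Rm]

lemma chi_Rm_mul (γ : GL2Z) : chi (Rm * γ) = chi γ := by
  simp [chi, Rm, Matrix.mul_apply, Fin.sum_univ_two]

lemma chi_mul_Rm (γ : GL2Z) :
    chi (γ * Rm) = if γ 1 0 = 0 then chi γ else -chi γ := by
  by_cases h : γ 1 0 = 0 <;> simp [chi, Rm, Matrix.mul_apply, Fin.sum_univ_two, h]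

lemma detZ_ne_zero (γ : GL2Z) : detZ γ ≠ 0 :=
  ((Matrix.isUnit_iff_isUnit_det _).1 γ.isUnit).ne_zero

lemma chi_ne_zero (γ : GL2Z) : chi γ ≠ 0 := by
  have hdet := detZ_ne_zero γ
  rw [detZ, Matrix.det_fin_two] at hdet
  unfold chi
  split_ifs with h
  · rintro h'
    simp [h, h'] at hdet
  · exact h

lemma KA_eq_ite (α β : GL2Z) :
    KA α β = (if detZ α < 0 ∧ detZ β < 0 then -1 else 1) *
      if ¬(chi (α * β) < 0 ↔ chi α < 0) ∧ ¬(chi (α * β) < 0 ↔ chi β * detZ α < 0)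
      then -1 else 1 := by
  rw [KA, hilb_intCast, ← Int.cast_mul, hilb_div_div (chi_ne_zero α)
    (mul_ne_zero (chi_ne_zero β) (detZ_ne_zero α)) (chi_ne_zero _)]

/-- If `β ∈ SL₂(ℤ)` is upper triangular, then `χ(αβ) = χ(α)χ(β)`. -/
lemma chi_mul_of_lower_left_eq_zero {α β : GL2Z} (hβ : detZ β = 1) (h : β 1 0 = 0) :
    chi (α * β) = chi α * chi β := by
  rw [detZ, Matrix.det_fin_two, h, mul_zero, sub_zero] at hβ
  have he : β 0 0 = β 1 1 := Int.eq_of_mul_eq_one hβ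
  have hne : β 1 1 ≠ 0 := right_ne_zero_of_mul_eq_one hβ
  by_cases hc : α 1 0 = 0 <;>
    simp [chi, Matrix.mul_apply, Fin.sum_univ_two, h, hc, he, hne]

/-- If `β ∈ SL₂(ℤ)` is not upper triangular but `αβ` is, then `χ(α) = -χ(αβ)χ(β)`. -/
lemma chi_left_of_mul_lower_left_eq_zero {α β : GL2Z} (hβ : detZ β = 1)
    (hg : β 1 0 ≠ 0) (h : (α * β) 1 0 = 0) :
    α 1 0 ≠ 0 ∧ chi α = -(chi (α * β) * chi β) := by
  have hc : α 1 0 = -(chi (α * β) * β 1 0) := by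
    rw [detZ, Matrix.det_fin_two] at hβ
    rw [chi, if_pos h]
    simp only [Units.val_mul, Matrix.mul_apply, Fin.sum_univ_two] at h ⊢
    linear_combination (-(α 1 0)) * hβ + β 1 1 * h
  have hne : α 1 0 ≠ 0 := by
    rw [hc]
    exact neg_ne_zero.2 (mul_ne_zero (chi_ne_zero _) hg)
  refine ⟨hne, ?_⟩
  rw [chi, if_neg hne, hc]
  congr 2
  rw [chi, if_neg hg]

/-- For all `α, β ∈ SL₂(ℤ)`:
`−A(R,αR)·A(R,Rβ)·A(RαR,RβR)·B(β) = A(αR,Rβ)·B(αβ)`. -/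
theorem KA_identity_10 (α β : GL2Z) (hα : detZ α = 1) (hβ : detZ β = 1) :
    -(KA Rm (α * Rm) * KA Rm (Rm * β) * KA (Rm * α * Rm) (Rm * β * Rm) * KB β)
      = KA (α * Rm) (Rm * β) * KB (α * β) := by
  have hRR (γ : GL2Z) : Rm * (Rm * γ) = γ := by rw [← mul_assoc, Rm_mul_Rm, one_mul]
  have ha := chi_ne_zero α
  have hb := chi_ne_zero β
  have hab := chi_ne_zero (α * β)
  have hg := chi_mul_of_lower_left_eq_zero (α := α) hβ
  have hp := chi_left_of_mul_lower_left_eq_zero (α := α) hβ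
  have hgp : β 1 0 = 0 → ((α * β) 1 0 = 0 ↔ α 1 0 = 0) := by
    intro h
    rw [detZ, Matrix.det_fin_two, h, mul_zero, sub_zero] at hβ
    simp [Matrix.mul_apply, Fin.sum_univ_two, h, left_ne_zero_of_mul_eq_one hβ]
  have hm := mul_neg_iff_xor ha hb
  have hm' := mul_neg_iff_xor hab hb
  have hR : chi (α * (β * Rm)) = _ := (mul_assoc α β Rm) ▸ chi_mul_Rm (α * β)
  simp only [KA_eq_ite, KB, hilb_intCast, detZ_mul, hα, hβ, detZ_Rm, mul_assoc, hRR,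
    chi_Rm_mul, chi_Rm, hR, chi_mul_Rm, mul_neg_one, mul_one]
  have hna : -chi α < 0 ↔ ¬chi α < 0 := by lia
  have hnb : -chi β < 0 ↔ ¬chi β < 0 := by lia
  have hnab : -chi (α * β) < 0 ↔ ¬chi (α * β) < 0 := by lia
  have hnm : -(chi (α * β) * chi β) < 0 ↔ (chi (α * β) < 0 ↔ chi β < 0) := by
    have := mul_ne_zero hab hb
    rw [← not_iff_not, ← hm']
    lia
  have h4 : β 1 0 = 0 → (chi (α * β) < 0 ↔ ¬(chi α < 0 ↔ chi β < 0)) := fun h => by rw [hg h, hm]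
  have h5 : β 1 0 ≠ 0 → (α * β) 1 0 = 0 → (chi α < 0 ↔ (chi (α * β) < 0 ↔ chi β < 0)) :=
    fun h h' => by rw [(hp h h').2, hnm]
  have h6 : β 1 0 ≠ 0 → (α * β) 1 0 = 0 → α 1 0 ≠ 0 := fun h h' => (hp h h').1
  clear hg hp hm hm' hnm hR hRR hα hβ ha hb hab
  revert hgp h4 h5 h6
  by_cases h1 : β 1 0 = 0 <;> by_cases h2 : (α * β) 1 0 = 0 <;> by_cases h3 : α 1 0 = 0 <;>
    simp only [h1, h2, h3, if_true, if_false, mul_one, neg_neg, ne_eq, hna, hnb, hnab] <;>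
    by_cases s1 : chi α < 0 <;> by_cases s2 : chi β < 0 <;>
    by_cases s3 : chi (α * β) < 0 <;> simp [s1, s2, s3]
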